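/- Let A, B ≥ 1, let (X,d) be an unbounded A-uniform metric space with d(x) > 0 for every x ∈ X, and let k be its quasihyperbolic metric. Let a, b, u ∈ X with d(a,b) ≤ (1/2)·d(a,u). Let α : [0,L_α] → X be a 1-short B-uniform curve from a to u, let β : [0,L_β] → X be a 1-short B-uniform curve from a to b, and let v = α(d(a,b)). Then there is a constant C depending only on A and B such that | k(v,u) − inf_{t ∈ [0,L_β]} k(u, β(t)) | ≤ C. -/

import Mathlib

open Metric Filter Set

noncomputable section

universe u v

/-- Gromov product of `x` and `y` with respect to base point `w`,
for a real-valued distance kernel `ρ`. -/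
def gromovProd {X : Type u} (ρ : X → X → ℝ) (w x y : X) : ℝ :=
  (ρ x w + ρ y w - ρ x y) / 2

/-- `(X, ρ)` is δ-hyperbolic. -/
def IsDeltaHyp {X : Type u} (ρ : X → X → ℝ) (δ : ℝ) : Prop :=
  ∀ x y z w : X, gromovProd ρ w x y ≥ min (gromovProd ρ w x z) (gromovProd ρ w z y) - δ

/-- `f` is a (λ,μ)-rough similarity. -/
def RoughSimilarity {X : Type u} {Y : Type v} [MetricSpace X] [MetricSpace Y]
    (lam mu : ℝ) (f : X → Y) : Prop :=
  (∀ y : Y, ∃ x : X, dist y (f x) ≤ mu) ∧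
  (∀ x x' : X, lam * dist x x' - mu ≤ dist (f x) (f x') ∧
    dist (f x) (f x') ≤ lam * dist x x' + mu)

/-- The distance from `x ∈ X` to the metric boundary `∂X = X̄ \ X`. -/
def distToBdry (X : Type u) [MetricSpace X] (x : X) : ℝ :=
  Metric.infDist (x : UniformSpace.Completion X)
    (Set.range ((↑) : X → UniformSpace.Completion X))ᶜ

/-- `X` is noncomplete, i.e. `∂X = X̄ \ X ≠ ∅`. -/
def IsNoncomplete (X : Type u) [MetricSpace X] : Prop :=
  ((Set.range ((↑) : X → UniformSpace.Completion X))ᶜ).Nonempty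

/-- Ibragimov's hyperbolization metric. -/
def hMetric (X : Type u) [MetricSpace X] (x y : X) : ℝ :=
  2 * Real.log ((dist x y + max (distToBdry X x) (distToBdry X y)) /
    Real.sqrt (distToBdry X x * distToBdry X y))

/-- The j̃-metric. -/
def jtMetric (X : Type u) [MetricSpace X] (x y : X) : ℝ :=
  (1 / 2) * Real.log ((1 + dist x y / distToBdry X x) * (1 + dist x y / distToBdry X y))

/-- The quasihyperbolic metric. -/
def quasihyperbolic (X : Type u) [MetricSpace X] (x y : X) : ℝ :=
  sInf {r : ℝ | ∃ L : ℝ, 0 ≤ L ∧ ∃ γ : ℝ → X,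
    LipschitzOnWith 1 γ (Set.Icc 0 L) ∧ γ 0 = x ∧ γ L = y ∧
    r = ∫ t in (0:ℝ)..L, (distToBdry X (γ t))⁻¹}

/-- `X` is an `A`-uniform metric space. -/
def IsUniformMS (X : Type u) [MetricSpace X] (A : ℝ) : Prop :=
  ∀ x y : X, ∃ L : ℝ, 0 ≤ L ∧ ∃ γ : ℝ → X,
    LipschitzOnWith 1 γ (Set.Icc 0 L) ∧ γ 0 = x ∧ γ L = y ∧
    L ≤ A * dist x y ∧ ∀ t ∈ Set.Icc (0:ℝ) L, min t (L - t) ≤ A * distToBdry X (γ t)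

/-- `X` is unbounded. -/
def IsUnbounded (X : Type u) [MetricSpace X] : Prop :=
  ¬ Bornology.IsBounded (Set.univ : Set X)

lemma continuous_distToBdry (X : Type u) [MetricSpace X] : Continuous (distToBdry X) :=
  (Metric.continuous_infDist_pt _).comp (UniformSpace.Completion.continuous_coe X)

lemma distToBdry_le_add_dist {X : Type u} [MetricSpace X] (x y : X) :
    distToBdry X x ≤ distToBdry X y + dist x y := by
  have h := Metric.infDist_le_infDist_add_dist (x := (x : UniformSpace.Completion X))
    (y := (y : UniformSpace.Completion X))
    (s := (Set.range ((↑) : X → UniformSpace.Completion X))ᶜ)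
  rwa [UniformSpace.Completion.dist_eq] at h

/-- The values of the integral defining the quasihyperbolic metric, over all admissible curves. -/
def qhLengths (X : Type u) [MetricSpace X] (x y : X) : Set ℝ :=
  {r : ℝ | ∃ L : ℝ, 0 ≤ L ∧ ∃ γ : ℝ → X,
    LipschitzOnWith 1 γ (Set.Icc 0 L) ∧ γ 0 = x ∧ γ L = y ∧
    r = ∫ t in (0:ℝ)..L, (distToBdry X (γ t))⁻¹}

section Quasihyperbolic

variable {X : Type u} [MetricSpace X]

lemma qhLengths_nonneg {x y : X} {r : ℝ} (hr : r ∈ qhLengths X x y) : 0 ≤ r := by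
  obtain ⟨L, hL, γ, -, -, -, rfl⟩ := hr
  exact intervalIntegral.integral_nonneg hL fun t _ => inv_nonneg.2 Metric.infDist_nonneg

lemma bddBelow_qhLengths (x y : X) : BddBelow (qhLengths X x y) :=
  ⟨0, fun _ hr => qhLengths_nonneg hr⟩

lemma quasihyperbolic_nonneg (x y : X) : 0 ≤ quasihyperbolic X x y :=
  Real.sInf_nonneg fun _ hr => qhLengths_nonneg hr

lemma IsUniformMS.qhLengths_nonempty {A : ℝ} (hX : IsUniformMS X A) (x y : X) :
    (qhLengths X x y).Nonempty := by
  obtain ⟨L, hL, γ, h1, h2, h3, -⟩ := hX x y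
  exact ⟨_, L, hL, γ, h1, h2, h3, rfl⟩

lemma quasihyperbolic_le_integral {γ : ℝ → X} {s t : ℝ} (hst : s ≤ t)
    (hγ : LipschitzOnWith 1 γ (Set.Icc s t)) :
    quasihyperbolic X (γ s) (γ t) ≤ ∫ r in s..t, (distToBdry X (γ r))⁻¹ := by
  refine csInf_le (bddBelow_qhLengths _ _) ⟨t - s, sub_nonneg.2 hst, fun r => γ (r + s), ?_, ?_,
    ?_, ?_⟩
  · intro p hp q hq
    have h := hγ (x := p + s) ⟨by linarith [hp.1], by linarith [hp.2]⟩
      (y := q + s) ⟨by linarith [hq.1], by linarith [hq.2]⟩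
    simpa using h
  · simp
  · simp
  · rw [intervalIntegral.integral_comp_add_right (fun r => (distToBdry X (γ r))⁻¹)]
    simp

/-- Lower bounds for the quasihyperbolic metric may be tested on globally Lipschitz curves. -/
lemma IsUniformMS.le_quasihyperbolic {A : ℝ} (hX : IsUniformMS X A) {x y : X} {c : ℝ}
    (h : ∀ (L : ℝ) (γ : ℝ → X), 0 ≤ L → LipschitzWith 1 γ → γ 0 = x → γ L = y →
      c ≤ ∫ t in (0:ℝ)..L, (distToBdry X (γ t))⁻¹) :
    c ≤ quasihyperbolic X x y := by
  refine le_csInf (hX.qhLengths_nonempty x y) ?_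
  rintro r ⟨L, hL, γ, hγ, h0, h1, rfl⟩
  have key := h L (fun t => γ (Set.projIcc 0 L hL t)) hL ?_ ?_ ?_
  · refine key.trans_eq (intervalIntegral.integral_congr fun t ht => ?_)
    rw [Set.uIcc_of_le hL] at ht
    simp [Set.projIcc_of_mem hL ht]
  · refine LipschitzWith.of_dist_le_mul fun p q => ?_
    have h1 := hγ.dist_le_mul _ (Set.projIcc 0 L hL p).2 _ (Set.projIcc 0 L hL q).2
    refine h1.trans ?_
    gcongr
    simpa [Subtype.dist_eq] using (LipschitzWith.projIcc hL).dist_le_mul p q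
  · simpa using h0
  · simpa using h1

lemma IsUniformMS.quasihyperbolic_comm {A : ℝ} (hX : IsUniformMS X A) (x y : X) :
    quasihyperbolic X x y = quasihyperbolic X y x := by
  suffices h : ∀ x y : X, quasihyperbolic X x y ≤ quasihyperbolic X y x from
    le_antisymm (h x y) (h y x)
  intro x y
  refine hX.le_quasihyperbolic fun L γ hL hγ h0 h1 => ?_
  have hrev : LipschitzWith 1 fun t => γ (L - t) := by
    refine LipschitzWith.of_dist_le_mul fun p q => (hγ.dist_le_mul _ _).trans_eq ?_
    rw [dist_sub_left]
  have h := quasihyperbolic_le_integral hL (hrev.lipschitzOnWith (s := Set.Icc 0 L))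
  rw [intervalIntegral.integral_comp_sub_left (fun r => (distToBdry X (γ r))⁻¹)] at h
  simpa [h0, h1] using h

lemma continuous_inv_distToBdry_comp (hpos : ∀ x : X, 0 < distToBdry X x) {γ : ℝ → X}
    (hγ : Continuous γ) : Continuous fun t => (distToBdry X (γ t))⁻¹ :=
  ((continuous_distToBdry X).comp hγ).inv₀ fun t => (hpos (γ t)).ne'

lemma lipschitzWith_concat {γ₁ γ₂ : ℝ → X} {L : ℝ} (h₁ : LipschitzWith 1 γ₁)
    (h₂ : LipschitzWith 1 γ₂) (h : γ₁ L = γ₂ 0) :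
    LipschitzWith 1 fun t => if t ≤ L then γ₁ t else γ₂ (t - L) := by
  have cross : ∀ p q : ℝ, p ≤ L → L < q → dist (γ₁ p) (γ₂ (q - L)) ≤ dist p q := by
    intro p q hp hq
    have e1 := h₁.dist_le_mul p L
    have e2 := h₂.dist_le_mul 0 (q - L)
    have e3 := dist_triangle (γ₁ p) (γ₂ 0) (γ₂ (q - L))
    rw [h] at e1
    simp only [NNReal.coe_one, one_mul, Real.dist_eq] at e1 e2 ⊢
    rw [abs_of_nonpos (by linarith)] at e1 e2 ⊢
    linarith
  refine LipschitzWith.of_dist_le_mul fun p q => ?_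
  simp only [NNReal.coe_one, one_mul]
  split_ifs with hp hq hq
  · simpa using h₁.dist_le_mul p q
  · exact cross p q hp (not_le.1 hq)
  · rw [dist_comm, dist_comm p]
    exact cross q p hq (not_le.1 hp)
  · simpa using h₂.dist_le_mul (p - L) (q - L)

lemma IsUniformMS.quasihyperbolic_triangle {A : ℝ} (hX : IsUniformMS X A)
    (hpos : ∀ x : X, 0 < distToBdry X x) (x y z : X) :
    quasihyperbolic X x z ≤ quasihyperbolic X x y + quasihyperbolic X y z := by
  rw [← sub_le_iff_le_add]
  refine hX.le_quasihyperbolic fun L₁ γ₁ hL₁ h₁ h₁0 h₁1 => ?_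
  rw [sub_le_comm]
  refine hX.le_quasihyperbolic fun L₂ γ₂ hL₂ h₂ h₂0 h₂1 => ?_
  rw [sub_le_iff_le_add']
  have hL : L₁ ≤ L₁ + L₂ := by linarith
  have hγ := lipschitzWith_concat h₁ h₂ (h₁1.trans h₂0.symm)
  have hc := continuous_inv_distToBdry_comp hpos hγ.continuous
  have h := quasihyperbolic_le_integral (add_nonneg hL₁ hL₂)
    (hγ.lipschitzOnWith (s := Set.Icc 0 (L₁ + L₂)))
  have e0 : (if (0:ℝ) ≤ L₁ then γ₁ 0 else γ₂ (0 - L₁)) = x := by rw [if_pos hL₁, h₁0]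
  have e1 : (if L₁ + L₂ ≤ L₁ then γ₁ (L₁ + L₂) else γ₂ (L₁ + L₂ - L₁)) = z := by
    split_ifs with hle
    · have : L₂ = 0 := by linarith
      subst this
      rw [add_zero, h₁1, ← h₂0, h₂1]
    · rw [add_sub_cancel_left, h₂1]
  rw [e0, e1, ← intervalIntegral.integral_add_adjacent_intervals
    (hc.intervalIntegrable 0 L₁) (hc.intervalIntegrable L₁ (L₁ + L₂))] at h
  refine h.trans_eq (congrArg₂ (· + ·) ?_ ?_)
  · refine intervalIntegral.integral_congr fun t ht => ?_
    rw [Set.uIcc_of_le hL₁] at ht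
    simp [ht.2]
  · have : ∫ t in (0:ℝ)..L₂, (distToBdry X (γ₂ t))⁻¹ =
        ∫ t in L₁..(L₁ + L₂), (distToBdry X (γ₂ (t - L₁)))⁻¹ := by
      rw [intervalIntegral.integral_comp_sub_right (fun r => (distToBdry X (γ₂ r))⁻¹)]
      simp
    rw [this]
    refine intervalIntegral.integral_congr fun t ht => ?_
    rw [Set.uIcc_of_le hL] at ht
    split_ifs with hle
    · have : t = L₁ := le_antisymm hle ht.1
      rw [this, h₁1, sub_self, h₂0]
    · rfl

/-- In a uniform space the quasihyperbolic metric is bounded logarithmically. -/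
lemma IsUniformMS.quasihyperbolic_le_log {A : ℝ} (hA : 1 ≤ A) (hX : IsUniformMS X A)
    (hpos : ∀ x : X, 0 < distToBdry X x) (x y : X) :
    quasihyperbolic X x y ≤ (1 + 2 * A) * (Real.log (1 + A * dist x y / distToBdry X x) +
      Real.log (1 + A * dist x y / distToBdry X y)) := by
  obtain ⟨L, hL, γ, hγ, h0, h1, hLA, hun⟩ := hX x y
  set p := distToBdry X x with hp
  set q := distToBdry X y with hq
  have hp0 : 0 < p := hpos x
  have hq0 : 0 < q := hpos y
  have hk := quasihyperbolic_le_integral hL hγ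
  rw [h0, h1] at hk
  have hc1 : ContinuousOn (fun t : ℝ => (p + t)⁻¹) (Set.uIcc 0 L) := by
    rw [Set.uIcc_of_le hL]
    exact ContinuousOn.inv₀ (by fun_prop) fun t ht => by linarith [ht.1]
  have hc2 : ContinuousOn (fun t : ℝ => (q + L - t)⁻¹) (Set.uIcc 0 L) := by
    rw [Set.uIcc_of_le hL]
    exact ContinuousOn.inv₀ (by fun_prop) fun t ht => by linarith [ht.2]
  have hc0 : ContinuousOn (fun t : ℝ => (distToBdry X (γ t))⁻¹) (Set.uIcc 0 L) := by
    rw [Set.uIcc_of_le hL]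
    exact ((continuous_distToBdry X).comp_continuousOn hγ.continuousOn).inv₀
      fun t _ => (hpos (γ t)).ne'
  have hbound : ∀ t ∈ Set.Icc 0 L, (distToBdry X (γ t))⁻¹ ≤
      (1 + 2 * A) * ((p + t)⁻¹ + (q + L - t)⁻¹) := by
    intro t ht
    have hd := hpos (γ t)
    have hu := hun t ht
    have hpt : 0 < p + t := by linarith [ht.1]
    have hqt : 0 < q + L - t := by linarith [ht.2]
    have key : ∀ r : ℝ, 0 < r → r ≤ (1 + 2 * A) * distToBdry X (γ t) →
        (distToBdry X (γ t))⁻¹ ≤ (1 + 2 * A) * r⁻¹ := by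
      intro r hr hle
      rw [← div_eq_mul_inv, inv_eq_one_div, div_le_div_iff₀ hd hr]
      linarith
    rw [mul_add]
    have hi1 : 0 ≤ (1 + 2 * A) * (p + t)⁻¹ := by positivity
    have hi2 : 0 ≤ (1 + 2 * A) * (q + L - t)⁻¹ := by positivity
    rcases le_total t (L - t) with hle | hle
    · rw [min_eq_left hle] at hu
      have e1 := distToBdry_le_add_dist x (γ t)
      have e2 := hγ.dist_le_mul 0 ⟨le_rfl, hL⟩ t ht
      rw [h0, Real.dist_eq, abs_of_nonpos (by linarith [ht.1])] at e2
      norm_num at e2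
      linarith [key (p + t) hpt (by linarith)]
    · rw [min_eq_right hle] at hu
      have e1 := distToBdry_le_add_dist y (γ t)
      have e2 := hγ.dist_le_mul L ⟨hL, le_rfl⟩ t ht
      rw [h1, Real.dist_eq, abs_of_nonneg (by linarith [ht.2])] at e2
      norm_num at e2
      linarith [key (q + L - t) hqt (by linarith)]
  have hI := intervalIntegral.integral_mono_on (μ := MeasureTheory.volume) hL hc0.intervalIntegrable
    ((hc1.intervalIntegrable.add hc2.intervalIntegrable).const_mul (1 + 2 * A)) hbound
  rw [intervalIntegral.integral_const_mul, intervalIntegral.integral_add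
    hc1.intervalIntegrable hc2.intervalIntegrable,
    intervalIntegral.integral_comp_add_left (fun t : ℝ => t⁻¹),
    intervalIntegral.integral_comp_sub_left (fun t : ℝ => t⁻¹),
    integral_inv_of_pos (by linarith) (by linarith),
    integral_inv_of_pos (by linarith) (by linarith)] at hI
  refine (hk.trans hI).trans ?_
  have hlog : ∀ r : ℝ, 0 < r → Real.log ((r + L) / r) ≤ Real.log (1 + A * dist x y / r) := by
    intro r hr
    rw [add_div, div_self hr.ne']
    gcongr
  have e1 := hlog p hp0
  have e2 := hlog q hq0
  refine mul_le_mul_of_nonneg_left ?_ (by linarith)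
  simpa using add_le_add e1 e2

end Quasihyperbolic

lemma mul_sub_le_of_exp_integral_le {f : ℝ → ℝ} (hf : Continuous f) {s L M c : ℝ} (hsL : s ≤ L)
    (hM : 0 < M) (h : ∀ t ∈ Set.Icc s L, c * Real.exp ((∫ r in t..L, f r) / M) ≤ f t) :
    c * (L - s) ≤ M := by
  have hderiv : ∀ t, HasDerivAt (fun t => Real.exp (-(∫ r in t..L, f r) / M))
      (Real.exp (-(∫ r in t..L, f r) / M) * (f t / M)) t := by
    intro t
    have h1 : HasDerivAt (fun t => ∫ r in t..L, f r) (-f t) t :=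
      intervalIntegral.integral_hasDerivAt_left (hf.intervalIntegrable _ _)
        hf.stronglyMeasurable.stronglyMeasurableAtFilter hf.continuousAt
    simpa using (h1.neg.div_const M).exp
  have hle := (convex_Icc s L).mul_sub_le_image_sub_of_le_deriv
    (f := fun t => Real.exp (-(∫ r in t..L, f r) / M))
    (fun t _ => (hderiv t).continuousAt.continuousWithinAt)
    (fun t _ => (hderiv t).differentiableAt.differentiableWithinAt) (C := c / M) ?_
    s ⟨le_rfl, hsL⟩ L ⟨hsL, le_rfl⟩ hsL
  · have hpos := Real.exp_pos (-(∫ r in s..L, f r) / M)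
    simp only [intervalIntegral.integral_same, neg_zero, zero_div, Real.exp_zero] at hle
    rw [div_mul_eq_mul_div] at hle
    have : c * (L - s) / M ≤ 1 := by linarith
    rwa [div_le_one hM] at this
  · intro t ht
    rw [interior_Icc] at ht
    rw [(hderiv t).deriv, ← mul_div_assoc]
    gcongr
    have h1 := mul_le_mul_of_nonneg_right (h t ⟨ht.1.le, ht.2.le⟩)
      (Real.exp_pos (-(∫ r in t..L, f r) / M)).le
    rw [mul_assoc, ← Real.exp_add] at h1
    rw [neg_div, add_neg_cancel, Real.exp_zero, mul_one] at h1
    rw [neg_div]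
    linarith

section Comparison

variable {X : Type u} [MetricSpace X]

lemma IsUniformMS.quasihyperbolic_le_of_dist_le {A : ℝ} (hA : 1 ≤ A) (hX : IsUniformMS X A)
    (hpos : ∀ x : X, 0 < distToBdry X x) {x y : X} {N : ℝ}
    (hx : dist x y ≤ N * distToBdry X x) (hy : dist x y ≤ N * distToBdry X y) :
    quasihyperbolic X x y ≤ (1 + 2 * A) * (2 * Real.log (1 + A * N)) := by
  refine (hX.quasihyperbolic_le_log hA hpos x y).trans ?_
  have aux : ∀ s : ℝ, 0 < s → dist x y ≤ N * s →
      Real.log (1 + A * dist x y / s) ≤ Real.log (1 + A * N) := by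
    intro s hs h
    have h1 : A * dist x y / s ≤ A * N := by
      rw [div_le_iff₀ hs, mul_assoc]
      gcongr
    have h2 : 0 ≤ A * dist x y / s := by positivity
    exact Real.log_le_log (by linarith) (by linarith)
  rw [two_mul (Real.log _)]
  exact mul_le_mul_of_nonneg_left (add_le_add (aux _ (hpos x) hx) (aux _ (hpos y) hy))
    (by linarith)

/-- If the final piece of length `R` of a curve stays at distance comparable to `R` from `v`, and
`v` is far from the boundary at that scale, then the curve is not much shorter than a
quasihyperbolic geodesic from its starting point to `v`. -/
lemma IsUniformMS.quasihyperbolic_le_integral_add {A : ℝ} (hA : 1 ≤ A) (hX : IsUniformMS X A)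
    (hpos : ∀ x : X, 0 < distToBdry X x) {v : X} {γ : ℝ → X} (hγ : LipschitzWith 1 γ)
    {L R N : ℝ} (hR : 0 < R) (hRL : R ≤ L) (hN : 1 ≤ N)
    (hv : ∀ t ∈ Set.Icc (L - R) L, dist (γ t) v ≤ N * R)
    (hv' : ∀ t ∈ Set.Icc (L - R) L, dist (γ t) v ≤ N * distToBdry X v) :
    quasihyperbolic X (γ 0) v ≤ (∫ t in (0:ℝ)..L, (distToBdry X (γ t))⁻¹) +
      (1 + 2 * A) * Real.log (2 * (1 + A * N) * (A * N) * (1 + 2 * A)) := by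
  by_contra! hlt
  have hc := continuous_inv_distToBdry_comp hpos hγ.continuous
  set M := 1 + 2 * A with hM
  set Q := 1 + A * N with hQ
  set J := quasihyperbolic X (γ 0) v - ∫ t in (0:ℝ)..L, (distToBdry X (γ t))⁻¹ with hJ
  have hM0 : 1 ≤ M := by linarith
  have hAN : 1 ≤ A * N := one_le_mul_of_one_le_of_one_le hA hN
  have hQ0 : 1 ≤ Q := by linarith
  have hT : 2 * Q * (A * N) * M < Real.exp (J / M) := by
    rw [← Real.log_lt_iff_lt_exp (by positivity), lt_div_iff₀ (by linarith)]
    linarith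
  have hT' : 2 * Q ≤ Real.exp (J / M) := by
    refine le_trans ?_ hT.le
    rw [mul_assoc]
    exact le_mul_of_one_le_right (by linarith) (one_le_mul_of_one_le_of_one_le hAN hM0)
  have hP : 0 < 2 * Q * (A * N * R) := by positivity
  have key := mul_sub_le_of_exp_integral_le hc (s := L - R) (L := L) (M := M)
    (c := Real.exp (J / M) / (2 * Q * (A * N * R))) (by linarith) (by linarith) ?_
  · rw [sub_sub_cancel, div_mul_eq_mul_div, div_le_iff₀ hP] at key
    have : R * (2 * Q * (A * N) * M) < R * Real.exp (J / M) := by gcongr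
    linarith
  · intro t ht
    have hg := hpos (γ t)
    have ht0 : 0 ≤ t := by linarith [ht.1]
    set I := ∫ r in t..L, (distToBdry X (γ r))⁻¹ with hI
    have hI0 : 0 ≤ I := intervalIntegral.integral_nonneg ht.2 fun r _ => inv_nonneg.2 (hpos _).le
    have hsplit := intervalIntegral.integral_add_adjacent_intervals
      (hc.intervalIntegrable (μ := MeasureTheory.volume) 0 t)
      (hc.intervalIntegrable (μ := MeasureTheory.volume) t L)
    have h1 := hX.quasihyperbolic_triangle hpos (γ 0) (γ t) v
    have h2 := quasihyperbolic_le_integral ht0 (hγ.lipschitzOnWith (s := Set.Icc 0 t))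
    have h3 := hX.quasihyperbolic_le_log hA hpos (γ t) v
    have h4 : Real.log (1 + A * dist (γ t) v / distToBdry X (γ t)) ≤
        Real.log (1 + A * N * R / distToBdry X (γ t)) := by
      have : A * dist (γ t) v ≤ A * N * R := by
        rw [mul_assoc]
        gcongr
        exact hv t ht
      gcongr
    have h5 : Real.log (1 + A * dist (γ t) v / distToBdry X v) ≤ Real.log Q := by
      have h6 : A * dist (γ t) v / distToBdry X v ≤ A * N := by
        rw [div_le_iff₀ (hpos v), mul_assoc]
        gcongr
        exact hv' t ht
      have h7 : 0 ≤ A * dist (γ t) v / distToBdry X v :=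
        div_nonneg (by positivity) (hpos v).le
      exact Real.log_le_log (by linarith) (by linarith)
    have hW : 0 < 1 + A * N * R / distToBdry X (γ t) := by positivity
    have h8 : (J + I) / M ≤ Real.log ((1 + A * N * R / distToBdry X (γ t)) * Q) := by
      rw [Real.log_mul hW.ne' (by linarith), div_le_iff₀ (by linarith), mul_comm]
      have := mul_le_mul_of_nonneg_left (add_le_add h4 h5) (by linarith : 0 ≤ M)
      linarith
    have h9 : Real.exp (J / M) * Real.exp (I / M) ≤
        (1 + A * N * R / distToBdry X (γ t)) * Q := by
      rw [← Real.exp_add, ← add_div]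
      exact (Real.le_log_iff_exp_le (by positivity)).1 h8
    have h10 : Real.exp (J / M) ≤ Real.exp (J / M) * Real.exp (I / M) :=
      le_mul_of_one_le_right (Real.exp_pos _).le (Real.one_le_exp (by positivity))
    have h11 : Real.exp (J / M) * Real.exp (I / M) ≤
        2 * Q * (A * N * R) * (distToBdry X (γ t))⁻¹ := by
      rw [div_eq_mul_inv (A * N * R)] at h9
      linarith
    rw [div_mul_eq_mul_div, div_le_iff₀ hP]
    linarith

end Comparison

/-- comparison of the quasihyperbolic distance from `u` to the
point `v = α(d(a,b))` on a 1-short B-uniform curve `α` from `a` to `u`, with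
the quasihyperbolic distance from `u` to a 1-short B-uniform curve `β`
from `a` to `b`. -/
theorem quasihyperbolic_dist_to_short_curve_comparison
    (A B : ℝ) (hA : 1 ≤ A) (hB : 1 ≤ B) :
    ∃ C : ℝ, ∀ (X : Type u) [MetricSpace X],
      IsUnbounded X → IsUniformMS X A → (∀ x : X, 0 < distToBdry X x) →
      ∀ (a b u : X) (Lα Lβ : ℝ) (α β : ℝ → X),
        dist a b ≤ (1 / 2) * dist a u →
        0 ≤ Lα → LipschitzOnWith 1 α (Set.Icc 0 Lα) → α 0 = a → α Lα = u →
        Lα ≤ B * dist a u →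
        (∀ t ∈ Set.Icc (0:ℝ) Lα, min t (Lα - t) ≤ B * distToBdry X (α t)) →
        (∫ t in (0:ℝ)..Lα, (distToBdry X (α t))⁻¹) ≤ quasihyperbolic X a u + 1 →
        0 ≤ Lβ → LipschitzOnWith 1 β (Set.Icc 0 Lβ) → β 0 = a → β Lβ = b →
        Lβ ≤ B * dist a b →
        (∀ t ∈ Set.Icc (0:ℝ) Lβ, min t (Lβ - t) ≤ B * distToBdry X (β t)) →
        (∫ t in (0:ℝ)..Lβ, (distToBdry X (β t))⁻¹) ≤ quasihyperbolic X a b + 1 →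
        |quasihyperbolic X (α (dist a b)) u -
            sInf ((fun t => quasihyperbolic X u (β t)) '' Set.Icc (0:ℝ) Lβ)| ≤ C := by
  set N := 2 * B * (B + 2) with hN
  set C₁ := (1 + 2 * A) * (2 * Real.log (1 + A * N)) with hC₁
  set C₂ := (1 + 2 * A) * Real.log (2 * (1 + A * N) * (A * N) * (1 + 2 * A)) with hC₂
  have hN1 : 1 ≤ N := by nlinarith
  have hC₁0 : 0 ≤ C₁ := by
    have := Real.log_nonneg (show 1 ≤ 1 + A * N by nlinarith)
    positivity
  refine ⟨max C₁ C₂, ?_⟩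
  intro X _ _ hX hpos a b u Lα Lβ α β hab hLα hα hα0 hα1 _ hαu _ hLβ hβ hβ0 hβ1 hLβB hβu _
  have hne : ((fun t => quasihyperbolic X u (β t)) '' Set.Icc (0:ℝ) Lβ).Nonempty :=
    ⟨_, 0, ⟨le_rfl, hLβ⟩, rfl⟩
  have hbdd : BddBelow ((fun t => quasihyperbolic X u (β t)) '' Set.Icc (0:ℝ) Lβ) := by
    refine ⟨0, ?_⟩
    rintro _ ⟨t, -, rfl⟩
    exact quasihyperbolic_nonneg _ _
  rw [hX.quasihyperbolic_comm]
  suffices hmain : (∃ t ∈ Set.Icc 0 Lβ, quasihyperbolic X (α (dist a b)) (β t) ≤ max C₁ C₂) ∧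
      ∀ t ∈ Set.Icc 0 Lβ, quasihyperbolic X u (α (dist a b)) ≤
        quasihyperbolic X u (β t) + max C₁ C₂ by
    obtain ⟨⟨t, ht, hle⟩, hlow⟩ := hmain
    rw [abs_le]
    constructor
    · have h1 := csInf_le hbdd ⟨t, ht, rfl⟩
      have h2 := hX.quasihyperbolic_triangle hpos u (α (dist a b)) (β t)
      dsimp only at h1
      linarith
    · rw [sub_le_comm]
      refine le_csInf hne ?_
      rintro _ ⟨t, ht, rfl⟩
      linarith [hlow t ht]
  have hβa : ∀ t ∈ Set.Icc 0 Lβ, dist (β t) a ≤ t := by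
    intro t ht
    have h := hβ.dist_le_mul t ht 0 ⟨le_rfl, hLβ⟩
    rw [hβ0] at h
    simpa [abs_of_nonneg ht.1] using h
  have hβb : ∀ t ∈ Set.Icc 0 Lβ, dist (β t) b ≤ Lβ - t := by
    intro t ht
    have h := hβ.dist_le_mul t ht Lβ ⟨hLβ, le_rfl⟩
    rw [hβ1, Real.dist_eq, abs_of_nonpos (by linarith [ht.2])] at h
    norm_num at h
    linarith
  have hD : dist a u ≤ Lα := by
    have h := hα.dist_le_mul 0 ⟨le_rfl, hLα⟩ Lα ⟨hLα, le_rfl⟩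
    rw [hα0, hα1] at h
    simpa [abs_of_nonneg hLα] using h
  have hd0 : 0 ≤ dist a b := dist_nonneg
  have hdm : dist a b ∈ Set.Icc 0 Lα := ⟨hd0, by linarith⟩
  have hva : dist (α (dist a b)) a ≤ dist a b := by
    have h := hα.dist_le_mul _ hdm 0 ⟨le_rfl, hLα⟩
    rw [hα0] at h
    simpa using h
  have hvd : dist a b ≤ B * distToBdry X (α (dist a b)) :=
    (le_min le_rfl (by linarith)).trans (hαu _ hdm)
  set d := dist a b with hd
  set v := α d with hv
  have hβv : ∀ t ∈ Set.Icc 0 Lβ, dist (β t) v ≤ (B + 1) * d := by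
    intro t ht
    linarith [dist_triangle_right (β t) v a, hβa t ht, ht.2]
  have hnear : ∀ t ∈ Set.Icc 0 Lβ, d ≤ 2 * (B * distToBdry X (β t)) →
      quasihyperbolic X (β t) v ≤ C₁ := by
    intro t ht hle
    refine hX.quasihyperbolic_le_of_dist_le hA hpos ((hβv t ht).trans ?_) ((hβv t ht).trans ?_)
    · have := mul_le_mul_of_nonneg_left hle (by linarith : 0 ≤ B + 2)
      linarith
    · have := mul_le_mul_of_nonneg_left hvd (by linarith : 0 ≤ B + 2)
      have : 0 ≤ B * (B + 2) * distToBdry X v :=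
        mul_nonneg (by positivity) (hpos v).le
      linarith
  have hLd : d ≤ Lβ := by
    have h := hβa Lβ ⟨hLβ, le_rfl⟩
    rwa [hβ1, dist_comm] at h
  constructor
  · refine ⟨Lβ / 2, ⟨by linarith, by linarith⟩, ?_⟩
    rw [hX.quasihyperbolic_comm]
    refine (hnear _ ⟨by linarith, by linarith⟩ ?_).trans (le_max_left _ _)
    have h := hβu (Lβ / 2) ⟨by linarith, by linarith⟩
    rw [sub_half, min_self] at h
    linarith
  · intro t ht
    rcases lt_or_ge (dist u (β t)) (d / 2) with hclose | hfar
    · have h1 := dist_triangle_right a u (β t)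
      have h2 := dist_triangle a b (β t)
      have h3 := hβa t ht
      have h4 := hβb t ht
      rw [dist_comm] at h3 h4
      have h5 : d / 2 ≤ min t (Lβ - t) := le_min (by linarith) (by linarith)
      have h6 := hnear t ht (by linarith [hβu t ht])
      linarith [hX.quasihyperbolic_triangle hpos u (β t) v, le_max_left C₁ C₂]
    rcases hd0.eq_or_lt with hd00 | hdpos
    · have h1 : dist (β t) v ≤ 0 := by simpa [← hd00] using hβv t ht
      rw [dist_le_zero.1 h1]
      linarith [le_max_left C₁ C₂]
    rw [← sub_le_iff_le_add]
    refine hX.le_quasihyperbolic fun L γ hL hγ h0 h1 => ?_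
    have hdist : ∀ s ∈ Set.Icc (L - d / 2) L, dist (γ s) v ≤ (B + 2) * d := by
      intro s hs
      have e1 := hγ.dist_le_mul s L
      rw [h1, Real.dist_eq, abs_of_nonpos (by linarith [hs.2])] at e1
      norm_num at e1
      linarith [dist_triangle (γ s) (β t) v, hβv t ht, hs.1]
    have hRL : d / 2 ≤ L := by
      have e1 := hγ.dist_le_mul 0 L
      rw [h0, h1, Real.dist_eq, abs_of_nonpos (by linarith)] at e1
      norm_num at e1
      linarith
    have key := hX.quasihyperbolic_le_integral_add hA hpos (v := v) hγ (R := d / 2) (N := N)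
      (by linarith) hRL hN1 (fun s hs => (hdist s hs).trans ?_) fun s hs => (hdist s hs).trans ?_
    · rw [h0] at key
      linarith [le_max_right C₁ C₂]
    · have := mul_le_mul_of_nonneg_right hB (by positivity : 0 ≤ (B + 2) * d)
      linarith
    · have := mul_le_mul_of_nonneg_left hvd (by linarith : 0 ≤ B + 2)
      have : 0 ≤ B * (B + 2) * distToBdry X v :=
        mul_nonneg (by positivity) (hpos v).le
      linarith

end
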